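/- For all constants c₁, c₂ > 0 there exists a constant c > 0 such that the following holds. If G, H, W, k, n satisfy Assumption (★) with constant c, then G contains a simple arc-system of size at least c₁·k² and length at least c₂·k^{1/5}. -/

import Mathlib

open Finset

/-- `σ` lists the vertices of `G` in the order of a Hamilton cycle `H`:
it is a bijection from `ZMod n` such that consecutive indices give adjacent vertices. -/
def IsHamOrder {V : Type} [Fintype V] (G : SimpleGraph V) (n : ℕ) (σ : ZMod n → V) : Prop :=
  Function.Bijective σ ∧ ∀ i : ZMod n, G.Adj (σ i) (σ (i + 1))

/-- A vertex is problematic if it has degree at most `2k` or belongs to `W`. -/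
def Problematic {V : Type} [Fintype V] [DecidableEq V] (G : SimpleGraph V)
    [DecidableRel G.Adj] (W : Finset V) (k : ℕ) (v : V) : Prop :=
  G.degree v ≤ 2 * k ∨ v ∈ W

/-- `G` has a cycle of length `ℓ` passing through all vertices of `S`. -/
def HasCycleThrough {V : Type} (G : SimpleGraph V) (ℓ : ℕ) (S : Set V) : Prop :=
  ∃ (u : V) (w : G.Walk u u), w.IsCycle ∧ w.length = ℓ ∧ ∀ x ∈ S, x ∈ w.support

/-- Assumption (★) with constant `c`: `G` is a graph on `n` vertices with Hamilton cycle
(order) `σ`, independence number at most `k`, `W` has at most `20k²` vertices, `G` has no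
cycle of length `n − 1` through all of `W`, and `n ≥ c·k^(11/5)`. -/
def StarAssumption {V : Type} [Fintype V] [DecidableEq V] (G : SimpleGraph V) [DecidableRel G.Adj]
    (n k : ℕ) (σ : ZMod n → V) (W : Finset V) (c : ℝ) : Prop :=
  Fintype.card V = n ∧ IsHamOrder G n σ ∧
  (∀ s : Finset V, (∀ u ∈ s, ∀ v ∈ s, u ≠ v → ¬ G.Adj u v) → s.card ≤ k) ∧
  W.card ≤ 20 * k ^ 2 ∧
  ¬ HasCycleThrough G (n - 1) (W : Set V) ∧
  c * (k : ℝ) ^ ((11 : ℝ) / 5) ≤ (n : ℝ)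

/-- Two vertices are consecutive if they are neighbours on the Hamilton cycle. -/
def Consec {V : Type} (n : ℕ) (σ : ZMod n → V) (u v : V) : Prop :=
  ∃ i : ZMod n, (σ i = u ∧ σ (i + 1) = v) ∨ (σ i = v ∧ σ (i + 1) = u)

/-- A continuous set of vertices: one forming a subpath (interval) of the Hamilton cycle. -/
def ContinuousSet {V : Type} [DecidableEq V] (n : ℕ) (σ : ZMod n → V) (S : Finset V) : Prop :=
  ∃ (i : ZMod n) (m : ℕ), S = (Finset.range m).image (fun j : ℕ => σ (i + (j : ZMod n)))

/-- `B` is a continuous closure of `A`: a minimum-size continuous set containing `A`. -/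
def IsClosure {V : Type} [DecidableEq V] (n : ℕ) (σ : ZMod n → V) (A B : Finset V) : Prop :=
  ContinuousSet n σ B ∧ A ⊆ B ∧
    ∀ B' : Finset V, ContinuousSet n σ B' → A ⊆ B' → B.card ≤ B'.card

/-- An arc-system: a family of arcs together with a choice of continuous closure for each
arc, such that closures of distinct arcs are disjoint, closures contain no problematic
vertex, and no arc contains two consecutive vertices. -/
structure ArcSystem {V : Type} [Fintype V] [DecidableEq V] (G : SimpleGraph V)
    [DecidableRel G.Adj] (n k : ℕ) (σ : ZMod n → V) (W : Finset V) where
  arcs : Finset (Finset V)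
  cl : Finset V → Finset V
  closure_spec : ∀ A ∈ arcs, IsClosure n σ A (cl A)
  closures_disjoint : ∀ A ∈ arcs, ∀ B ∈ arcs, A ≠ B → Disjoint (cl A) (cl B)
  no_problematic : ∀ A ∈ arcs, ∀ v ∈ cl A, ¬ Problematic G W k v
  no_consec : ∀ A ∈ arcs, ∀ u ∈ A, ∀ v ∈ A, u ≠ v → ¬ Consec n σ u v

namespace ArcSystem

variable {V : Type} [Fintype V] [DecidableEq V] {G : SimpleGraph V} [DecidableRel G.Adj]
  {n k : ℕ} {σ : ZMod n → V} {W : Finset V}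

/-- An arc-system is independent if every closure has at most `k` vertices. -/
def Independent (𝒜 : ArcSystem G n k σ W) : Prop :=
  ∀ A ∈ 𝒜.arcs, (𝒜.cl A).card ≤ k

/-- Every arc of the system has at least `l` vertices. -/
def LengthGe (𝒜 : ArcSystem G n k σ W) (l : ℕ) : Prop :=
  ∀ A ∈ 𝒜.arcs, l ≤ A.card

end ArcSystem

/-- A vertex set `s` is `M₂`-free (for `G`) if the subgraph induced by `s`
contains no two vertex-disjoint edges. -/
def M2Free {V : Type} (G : SimpleGraph V) (s : Finset V) : Prop :=
  ¬ ∃ a b x y : V, a ∈ s ∧ b ∈ s ∧ x ∈ s ∧ y ∈ s ∧ G.Adj a b ∧ G.Adj x y ∧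
      a ≠ x ∧ a ≠ y ∧ b ≠ x ∧ b ≠ y

namespace ArcSystem

variable {V : Type} [Fintype V] [DecidableEq V] {G : SimpleGraph V} [DecidableRel G.Adj]
  {n k : ℕ} {σ : ZMod n → V} {W : Finset V}

/-- An arc-system is simple if it is independent and any two distinct arcs induce an
`M₂`-free subgraph of `G`. -/
def Simple (𝒜 : ArcSystem G n k σ W) : Prop :=
  𝒜.Independent ∧ ∀ A ∈ 𝒜.arcs, ∀ B ∈ 𝒜.arcs, A ≠ B → M2Free G (A ∪ B)

end ArcSystem

/-- `G[𝒜]` contains an independent set of size at least `m`. -/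
def HasIndepInArcs {V : Type} [Fintype V] [DecidableEq V] (G : SimpleGraph V)
    [DecidableRel G.Adj] {n k : ℕ} {σ : ZMod n → V} {W : Finset V}
    (𝒜 : ArcSystem G n k σ W) (m : ℕ) : Prop :=
  ∃ I : Finset V, (∀ v ∈ I, ∃ A ∈ 𝒜.arcs, v ∈ A) ∧
    (∀ u ∈ I, ∀ v ∈ I, u ≠ v → ¬ G.Adj u v) ∧ m ≤ I.card

/-- The constants `a_p = 10·3^p`. -/
def aP (p : ℕ) : ℕ := 10 * 3 ^ p

/-- The constants `b_p = 1000^p·4^(p²)`. -/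
def bP (p : ℕ) : ℕ := 1000 ^ p * 4 ^ (p ^ 2)


theorem greedy_indep {α : Type*} [DecidableEq α] (R : α → α → Prop) [DecidableRel R]
    (hR : ∀ u v, R u v → R v u) (D : ℕ) (N : ℕ) : ∀ S : Finset α, S.card = N →
    (∀ T ⊆ S, T.Nonempty → ∃ v ∈ T, (T.filter (fun u => u ≠ v ∧ R v u)).card ≤ D) →
    ∃ I ⊆ S, (∀ u ∈ I, ∀ v ∈ I, u ≠ v → ¬ R u v) ∧ S.card ≤ (D + 1) * I.card := by
  induction N using Nat.strong_induction_on with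
  | _ N ih =>
  intro S hN hS
  rcases S.eq_empty_or_nonempty with rfl | hne
  · exact ⟨∅, by simp, by simp, by simp⟩
  obtain ⟨v, hv, hd⟩ := hS S (Subset.refl _) hne
  set F := S.filter (fun u => u ≠ v ∧ R v u) with hF
  set S' := S.filter (fun u => u ≠ v ∧ ¬ R v u) with hS'
  have hsub : S' ⊆ S := filter_subset _ _
  have hunion : S ⊆ insert v (F ∪ S') := by
    intro u hu
    by_cases h1 : u = v <;> by_cases h2 : R v u <;> simp [hF, hS', h1, h2, hu]
  have hc : S.card ≤ 1 + D + S'.card := by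
    have h1 := card_le_card hunion
    have h2 := card_insert_le v (F ∪ S')
    have h3 := card_union_le F S'
    omega
  have hlt : S'.card < N := by
    rw [← hN]
    apply card_lt_card
    refine ⟨hsub, fun h => ?_⟩
    have := h hv
    simp [hS'] at this
  obtain ⟨I, hI, hind, hcard⟩ := ih _ hlt S' rfl (fun T hT => hS T (hT.trans hsub))
  have hvI : v ∉ I := fun h => by
    have := hI h
    simp [hS'] at this
  refine ⟨insert v I, ?_, ?_, ?_⟩
  · intro u hu
    rcases mem_insert.1 hu with rfl | hu
    · exact hv
    · exact hsub (hI hu)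
  · intro a ha b hb hab
    rcases mem_insert.1 ha with rfl | ha' <;> rcases mem_insert.1 hb with rfl | hb'
    · exact absurd rfl hab
    · have := hI hb'
      simp only [hS', mem_filter] at this
      exact this.2.2
    · have := hI ha'
      simp only [hS', mem_filter] at this
      exact fun h => this.2.2 (hR _ _ h)
    · exact hind a ha' b hb' hab
  · rw [card_insert_of_notMem hvI]
    nlinarith

theorem noncrossing_indep (R : ℕ → ℕ → Prop) (hR : ∀ u v, R u v → R v u) (S : Finset ℕ)
    (hnc : ∀ p ∈ S, ∀ q ∈ S, ∀ r ∈ S, ∀ s ∈ S, p < q → q < r → r < s → R p r → R q s → False) :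
    ∃ I ⊆ S, (∀ u ∈ I, ∀ v ∈ I, u ≠ v → ¬ R u v) ∧ S.card ≤ 3 * I.card := by
  classical
  apply greedy_indep R hR 2 _ S rfl
  intro T hT hne
  -- a vertex all of whose neighbours are order-consecutive in `T`
  have key : ∃ v ∈ T, ∀ t ∈ T, t ≠ v → R v t →
      ∀ j ∈ T, ¬ (v < j ∧ j < t) ∧ ¬ (t < j ∧ j < v) := by
    by_cases hlong : ∃ L p q j, p ∈ T ∧ q ∈ T ∧ j ∈ T ∧ p < j ∧ j < q ∧ R p q ∧ q = p + L
    · obtain ⟨p, q, j, hp, hq, hj, hpj, hjq, hpq, hL⟩ := Nat.find_spec hlong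
      have hmin := fun L hL => Nat.find_min hlong (m := L) hL
      refine ⟨j, hj, fun t ht htj hjt i hi => ?_⟩
      have ht1 : p ≤ t := by
        by_contra hh
        exact hnc t (hT ht) p (hT hp) j (hT hj) q (hT hq) (by omega) hpj hjq (hR _ _ hjt) hpq
      have ht2 : t ≤ q := by
        by_contra hh
        exact hnc p (hT hp) j (hT hj) q (hT hq) t (hT ht) (by omega) hjq (by omega) hpq hjt
      constructor
      · rintro ⟨h1, h2⟩
        exact hmin (t - j) (by omega) ⟨j, t, i, hj, ht, hi, h1, h2, hjt, by omega⟩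
      · rintro ⟨h1, h2⟩
        exact hmin (j - t) (by omega) ⟨t, j, i, ht, hj, hi, h1, h2, hR _ _ hjt, by omega⟩
    · obtain ⟨v, hv⟩ := hne
      refine ⟨v, hv, fun t ht htj hjt i hi => ⟨?_, ?_⟩⟩
      · rintro ⟨h1, h2⟩
        exact hlong ⟨t - v, v, t, i, hv, ht, hi, h1, h2, hjt, by omega⟩
      · rintro ⟨h1, h2⟩
        exact hlong ⟨v - t, t, v, i, ht, hv, hi, h1, h2, hR _ _ hjt, by omega⟩
  obtain ⟨v, hv, hk⟩ := key
  refine ⟨v, hv, ?_⟩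
  have h1 : (T.filter (fun u => u ≠ v ∧ R v u)) ⊆
      (T.filter (fun u => v < u ∧ R v u)) ∪ (T.filter (fun u => u < v ∧ R v u)) := by
    intro u hu
    simp only [mem_filter, mem_union] at hu ⊢
    rcases lt_or_gt_of_ne hu.2.1 with h | h
    · exact Or.inr ⟨hu.1, h, hu.2.2⟩
    · exact Or.inl ⟨hu.1, h, hu.2.2⟩
  have h2 : (T.filter (fun u => v < u ∧ R v u)).card ≤ 1 := by
    rw [card_le_one]
    intro a ha b hb
    simp only [mem_filter] at ha hb
    have e1 := (hk a ha.1 (by omega) ha.2.2 b hb.1).1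
    have e2 := (hk b hb.1 (by omega) hb.2.2 a ha.1).1
    omega
  have h3 : (T.filter (fun u => u < v ∧ R v u)).card ≤ 1 := by
    rw [card_le_one]
    intro a ha b hb
    simp only [mem_filter] at ha hb
    have e1 := (hk a ha.1 (by omega) ha.2.2 b hb.1).2
    have e2 := (hk b hb.1 (by omega) hb.2.2 a ha.1).2
    omega
  have := card_le_card h1
  have := card_union_le (T.filter (fun u => v < u ∧ R v u)) (T.filter (fun u => u < v ∧ R v u))
  omega

/-- A cyclic list of distinct vertices of `G`, consecutive ones being adjacent. -/
def CycL {V : Type} (G : SimpleGraph V) (l : List V) : Prop :=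
  l.Nodup ∧ l.IsChain G.Adj ∧ ∀ x ∈ l.getLast?, ∀ y ∈ l.head?, G.Adj x y

theorem hasCycle_of_cycL {V : Type} (G : SimpleGraph V) (l : List V) (hl : CycL G l)
    (h3 : 3 ≤ l.length) (S : Set V) (hS : ∀ x ∈ S, x ∈ l) : HasCycleThrough G l.length S := by
  obtain ⟨hnd, hch, hcl⟩ := hl
  have hne : l ≠ [] := by rintro rfl; simp at h3
  have hadj : G.Adj (l.getLast hne) (l.head hne) :=
    hcl _ (List.getLast?_eq_some_getLast hne) _ (List.head?_eq_some_head hne)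
  set p := SimpleGraph.Walk.ofSupport l hne hch with hp
  have hsup : p.support = l := SimpleGraph.Walk.support_ofSupport hne hch
  have hpath : p.IsPath := by
    rw [SimpleGraph.Walk.isPath_def, hsup]; exact hnd
  have hlen : p.length + 1 = l.length := by
    rw [← SimpleGraph.Walk.length_support, hsup]
  refine ⟨_, SimpleGraph.Walk.cons hadj p, ?_, ?_, ?_⟩
  · rw [SimpleGraph.Walk.cons_isCycle_iff]
    refine ⟨hpath, fun h => ?_⟩
    rw [Sym2.eq_swap] at h
    have := hpath.length_eq_one_of_mem_edges h
    omega
  · simp [hlen]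
  · intro x hx
    rw [SimpleGraph.Walk.support_cons, hsup]
    exact List.mem_cons_of_mem _ (hS x hx)

theorem cycL_insert {V : Type} [DecidableEq V] (G : SimpleGraph V) [DecidableRel G.Adj] (k : ℕ)
    (hα : ∀ s : Finset V, (∀ u ∈ s, ∀ v ∈ s, u ≠ v → ¬ G.Adj u v) → s.card ≤ k)
    (l : List V) (hl : CycL G l) (v : V) (hv : v ∉ l)
    (hdeg : k + 1 ≤ (l.toFinset.filter (fun u => G.Adj v u)).card) :
    ∃ l', CycL G l' ∧ l'.Perm (v :: l) := by
  obtain ⟨hnd, hch, hcl⟩ := hl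
  set N := l.length with hN
  have hlne : l ≠ [] := by rintro rfl; simp at hdeg
  have hNpos : 0 < N := List.length_pos_iff.2 hlne
  let g : ℕ → V := fun i => if h : i < N then l[i] else v
  have hg : ∀ i (h : i < N), g i = l[i] := fun i h => by simp [g, h]
  have ginj : ∀ i < N, ∀ j < N, g i = g j → i = j := by
    intro i hi j hj h
    rw [hg i hi, hg j hj] at h
    exact (List.Nodup.getElem_inj_iff hnd).1 h
  have gmem : ∀ i < N, g i ∈ l := fun i hi => by rw [hg i hi]; exact List.getElem_mem _
  let I := (Finset.range (N - 1)).filter (fun i => G.Adj v (g i))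
  have hIk : k ≤ I.card := by
    have hsub : l.toFinset.filter (fun u => G.Adj v u) ⊆ insert (g (N - 1)) (I.image g) := by
      intro u hu
      simp only [mem_filter, List.mem_toFinset] at hu
      obtain ⟨i, hi, rfl⟩ := List.getElem_of_mem hu.1
      have hgi := hg i hi
      rw [← hgi] at hu ⊢
      by_cases h : i = N - 1
      · simp [h]
      · refine mem_insert_of_mem (mem_image_of_mem _ ?_)
        simp only [I, mem_filter, Finset.mem_range]
        exact ⟨by omega, hu.2⟩
    have h1 := card_le_card hsub
    have h2 := card_insert_le (g (N - 1)) (I.image g)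
    have h3 : (I.image g).card ≤ I.card := card_image_le
    omega
  let T := insert v (I.image (fun i => g (i + 1)))
  have hI : ∀ i ∈ I, i + 1 < N ∧ G.Adj v (g i) := by
    intro i hi
    simp only [I, mem_filter, Finset.mem_range] at hi
    exact ⟨by omega, hi.2⟩
  have hTcard : k + 1 ≤ T.card := by
    rw [card_insert_of_notMem, card_image_of_injOn]
    · omega
    · intro i hi j hj h
      have := ginj _ (hI i hi).1 _ (hI j hj).1 h
      omega
    · intro h
      obtain ⟨i, hi, h⟩ := mem_image.1 h
      apply hv
      rw [← h]
      exact gmem _ (hI i hi).1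
  have hnot : ¬ (∀ u ∈ T, ∀ w ∈ T, u ≠ w → ¬ G.Adj u w) := fun h => by
    have := hα T h
    omega
  -- inserting `v` straight between two consecutive vertices
  have case1 : ∀ i ∈ I, G.Adj v (g (i + 1)) → ∃ l', CycL G l' ∧ l'.Perm (v :: l) := by
    intro i hi hadj
    obtain ⟨hi1, hvi⟩ := hI i hi
    have hperm : (l.take (i + 1) ++ v :: l.drop (i + 1)).Perm (v :: l) := by
      refine List.perm_middle.trans ?_
      rw [List.take_append_drop]
    have hlast : (l.take (i+1)).getLast? = some (g i) := by
      rw [List.getLast?_eq_getElem?, List.getElem?_take, hg i (by omega)]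
      simp only [List.length_take]
      rw [if_pos (by omega), show min (i+1) l.length - 1 = i by omega]
      exact List.getElem?_eq_getElem _
    have hhead : (l.drop (i+1)).head? = some (g (i+1)) := by
      rw [List.head?_drop, hg (i+1) hi1]
      exact List.getElem?_eq_getElem _
    have hwhole : l = l.take (i+1) ++ l.drop (i+1) := (List.take_append_drop _ _).symm
    rw [hwhole, List.isChain_append] at hch
    have ha : l.take (i+1) ≠ [] := by intro h; rw [h] at hlast; simp at hlast
    have hb : l.drop (i+1) ≠ [] := by intro h; rw [h] at hhead; simp at hhead
    refine ⟨_, ⟨hperm.nodup_iff.2 (List.nodup_cons.2 ⟨hv, hnd⟩), ?_, ?_⟩, hperm⟩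
    · rw [List.isChain_append]
      refine ⟨hch.1, ?_, ?_⟩
      · rw [List.isChain_cons]
        refine ⟨?_, hch.2.1⟩
        rw [hhead]; simpa using hadj
      · rw [hlast]; simpa using hvi.symm
    · rw [hwhole] at hcl
      rw [List.head?_append_of_ne_nil _ ha, List.getLast?_append_of_ne_nil _ hb] at hcl
      rw [List.head?_append_of_ne_nil _ ha, List.getLast?_append_of_ne_nil _ (by simp),
        List.getLast?_cons_of_ne_nil hb]
      exact hcl
  have case2 : ∀ i ∈ I, ∀ j ∈ I, i < j → G.Adj (g (i + 1)) (g (j + 1)) →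
      ∃ l', CycL G l' ∧ l'.Perm (v :: l) := by
    intro i hi j hj hij hadj
    obtain ⟨hi1, hvi⟩ := hI i hi
    obtain ⟨hj1, hvj⟩ := hI j hj
    obtain ⟨a, b, c, habc, hla, hlb⟩ : ∃ a b c, l = a ++ (b ++ c) ∧ a.length = i + 1 ∧
        b.length = j - i := by
      refine ⟨l.take (i+1), (l.drop (i+1)).take (j-i), (l.drop (i+1)).drop (j-i), ?_, ?_, ?_⟩
      · rw [List.take_append_drop, List.take_append_drop]
      · simp; omega
      · simp; omega
    have hlc : a.length + b.length + c.length = N := by rw [hN, habc]; simp; omega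
    have ga : a.getLast? = some (g i) := by
      rw [hg i (by omega), List.getLast?_eq_getElem?, ← List.getElem?_eq_getElem, habc,
        List.getElem?_append_left (by omega), hla]; rfl
    have gb : b.head? = some (g (i+1)) := by
      rw [hg (i+1) (by omega), List.head?_eq_getElem?, ← List.getElem?_eq_getElem, habc,
        List.getElem?_append_right (by omega), List.getElem?_append_left (by omega), hla]; simp
    have gb' : b.getLast? = some (g j) := by
      rw [hg j (by omega), List.getLast?_eq_getElem?, ← List.getElem?_eq_getElem, habc,
        List.getElem?_append_right (by omega), List.getElem?_append_left (by omega)]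
      congr 1; omega
    have gc : c.head? = some (g (j+1)) := by
      rw [hg (j+1) (by omega), List.head?_eq_getElem?, ← List.getElem?_eq_getElem, habc,
        List.getElem?_append_right (by omega), List.getElem?_append_right (by omega)]
      congr 1; omega
    have ha : a ≠ [] := by intro h; rw [h] at ga; simp at ga
    have hb : b ≠ [] := by intro h; rw [h] at gb; simp at gb
    have hc : c ≠ [] := by intro h; rw [h] at gc; simp at gc
    have hperm : (a ++ v :: (b.reverse ++ c)).Perm (v :: l) := by
      refine List.perm_middle.trans ?_
      rw [habc]
      exact ((List.reverse_perm b).append_right c |>.append_left a).cons v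
    rw [habc, List.isChain_append, List.isChain_append] at hch
    refine ⟨_, ⟨hperm.nodup_iff.2 (List.nodup_cons.2 ⟨hv, hnd⟩), ?_, ?_⟩, hperm⟩
    · rw [List.isChain_append, List.isChain_cons, List.isChain_append, List.isChain_reverse]
      refine ⟨hch.1, ⟨?_, ?_, hch.2.1.2.1, ?_⟩, ?_⟩
      · rw [List.head?_append_of_ne_nil _ (by simpa using hb), List.head?_reverse, gb']
        simpa using hvj
      · exact hch.2.1.1.imp (fun _ _ h => h.symm)
      · rw [List.getLast?_reverse, gb, gc]; simpa using hadj
      · rw [ga]; simpa using hvi.symm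
    · rw [habc] at hcl
      rw [List.head?_append_of_ne_nil _ ha, List.getLast?_append_of_ne_nil _ (by simp [hc]),
        List.getLast?_append_of_ne_nil _ hc] at hcl
      rw [List.head?_append_of_ne_nil _ ha, List.getLast?_append_of_ne_nil _ (by simp),
        List.getLast?_cons_of_ne_nil (by simp [hc]), List.getLast?_append_of_ne_nil _ hc]
      exact hcl
  push Not at hnot
  obtain ⟨u, hu, w, hw, huw, hadj⟩ := hnot
  rcases mem_insert.1 hu with rfl | hu <;> rcases mem_insert.1 hw with rfl | hw
  · exact absurd rfl huw
  · obtain ⟨i, hi, rfl⟩ := mem_image.1 hw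
    exact case1 i hi hadj
  · obtain ⟨i, hi, rfl⟩ := mem_image.1 hu
    exact case1 i hi hadj.symm
  · obtain ⟨i, hi, rfl⟩ := mem_image.1 hu
    obtain ⟨j, hj, rfl⟩ := mem_image.1 hw
    rcases lt_trichotomy i j with h | h | h
    · exact case2 i hi j hj h hadj
    · exact absurd (by rw [h]) huw
    · exact case2 j hj i hi h hadj.symm

/-- A cyclic list missing at least one and at most `8k` vertices, all of high degree and outside
`W`, can be completed to a cycle of length `n - 1` through `W`. -/
theorem cycle_of_missing {V : Type} [Fintype V] [DecidableEq V] (G : SimpleGraph V)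
    [DecidableRel G.Adj] (k : ℕ) (_hk : 1 ≤ k) (W : Finset V)
    (hα : ∀ s : Finset V, (∀ u ∈ s, ∀ v ∈ s, u ≠ v → ¬ G.Adj u v) → s.card ≤ k)
    (hn : 4 ≤ Fintype.card V) (M : ℕ) : ∀ l : List V, CycL G l →
    l.length + (M + 1) = Fintype.card V → M + 1 ≤ 8 * k →
    (∀ v, v ∉ l → 10 * k < G.degree v ∧ v ∉ W) →
    HasCycleThrough G (Fintype.card V - 1) (W : Set V) := by
  induction M with
  | zero =>
    intro l hl hlen _ hW
    have := hasCycle_of_cycL G l hl (by omega) (W : Set V) (fun x hx => by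
      by_contra h
      exact (hW x h).2 hx)
    rwa [show Fintype.card V - 1 = l.length by omega]
  | succ M ih =>
    intro l hl hlen hM hW
    have hex : ∃ v, v ∉ l := by
      by_contra h
      push Not at h
      have : (Finset.univ : Finset V) ⊆ l.toFinset := fun x _ => by simpa using h x
      have h1 := card_le_card this
      have h2 := l.toFinset_card_le
      rw [Finset.card_univ] at h1
      omega
    obtain ⟨v, hv⟩ := hex
    have hd := (hW v hv).1
    have hcompl : (Finset.univ \ l.toFinset).card = M + 1 + 1 := by
      rw [Finset.card_univ_sdiff, List.toFinset_card_of_nodup hl.1]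
      omega
    have hsub : G.neighborFinset v ⊆
        l.toFinset.filter (fun u => G.Adj v u) ∪ (Finset.univ \ l.toFinset) := by
      intro u hu
      rw [SimpleGraph.mem_neighborFinset] at hu
      by_cases h : u ∈ l <;> simp [h, hu]
    have h1 := card_le_card hsub
    have h2 := card_union_le (l.toFinset.filter (fun u => G.Adj v u)) (Finset.univ \ l.toFinset)
    rw [SimpleGraph.card_neighborFinset_eq_degree] at h1
    obtain ⟨l', hl', hp⟩ := cycL_insert G k hα l hl v hv (by omega)
    have hlen' := hp.length_eq
    rw [List.length_cons] at hlen'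
    refine ih l' hl' (by omega) (by omega) (fun u hu => hW u (fun h => hu ?_))
    exact hp.mem_iff.2 (List.mem_cons_of_mem _ h)

/-- The list `a, a+1, …, b`. -/
def segL (a b : ℕ) : List ℕ := List.range' a (b + 1 - a)

theorem mem_segL {a b i : ℕ} : i ∈ segL a b ↔ a ≤ i ∧ i ≤ b := by
  rw [segL, List.mem_range'_1]; omega

theorem nodup_segL (a b : ℕ) : (segL a b).Nodup := List.nodup_range'

theorem head_segL {a b : ℕ} (h : a ≤ b) : (segL a b).head? = some a := by
  rw [segL, List.head?_range', if_neg (by omega)]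

theorem last_segL {a b : ℕ} (h : a ≤ b) : (segL a b).getLast? = some b := by
  rw [segL, List.getLast?_range', if_neg (by omega)]
  congr 1; omega

theorem chain_segL (R : ℕ → ℕ → Prop) (hR : ∀ i, R i (i + 1)) (a b : ℕ) :
    (segL a b).IsChain R := by
  refine (List.isChain_range' a (b + 1 - a) 1).imp ?_
  rintro x y rfl
  exact hR x

/-- The setting after passing to positions along the Hamilton cycle. -/
structure Setting {V : Type} [Fintype V] [DecidableEq V] (G : SimpleGraph V)
    [DecidableRel G.Adj] (n k : ℕ) (W : Finset V) (f : ℕ → V) : Prop where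
  card : Fintype.card V = n
  four : 4 ≤ n
  kpos : 1 ≤ k
  alpha : ∀ s : Finset V, (∀ u ∈ s, ∀ v ∈ s, u ≠ v → ¬ G.Adj u v) → s.card ≤ k
  nocyc : ¬ HasCycleThrough G (n - 1) (W : Set V)
  inj : ∀ i < n, ∀ j < n, f i = f j → i = j
  surj : ∀ v, ∃ i < n, f i = v
  adj : ∀ i, G.Adj (f i) (f (i + 1))
  wrap : G.Adj (f (n - 1)) (f 0)

/-- A position whose vertex has degree more than `10k` and is not in `W`. -/
def GoodPos {V : Type} [Fintype V] [DecidableEq V] (G : SimpleGraph V)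
    [DecidableRel G.Adj] (k : ℕ) (W : Finset V) (f : ℕ → V) (i : ℕ) : Prop :=
  10 * k < G.degree (f i) ∧ f i ∉ W

section
variable {V : Type} [Fintype V] [DecidableEq V] {G : SimpleGraph V}
    [DecidableRel G.Adj] {n k : ℕ} {W : Finset V} {f : ℕ → V}

theorem Setting.no_list (S : Setting G n k W f) (P : List ℕ) (hnd : P.Nodup)
    (hlt : ∀ i ∈ P, i < n) (hch : P.IsChain (fun i j => G.Adj (f i) (f j)))
    (hcl : ∀ x ∈ P.getLast?, ∀ y ∈ P.head?, G.Adj (f x) (f y))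
    (q : ℕ) (hq : q < n) (hqP : q ∉ P) (E : Finset ℕ) (hE : E.card ≤ 8 * k)
    (hPE : ∀ i < n, i ∉ P → i ∈ E) (hgood : ∀ i ∈ E, GoodPos G k W f i) : False := by
  have hcyc : CycL G (P.map f) := by
    refine ⟨?_, ?_, ?_⟩
    · rw [List.nodup_map_iff_inj_on hnd]
      intro x hx y hy h
      exact S.inj x (hlt x hx) y (hlt y hy) h
    · rw [List.isChain_map]; exact hch
    · intro x hx y hy
      rw [List.getLast?_map] at hx
      rw [List.head?_map] at hy
      simp only [Option.mem_def, Option.map_eq_some_iff] at hx hy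
      obtain ⟨x', hx', rfl⟩ := hx
      obtain ⟨y', hy', rfl⟩ := hy
      exact hcl x' hx' y' hy'
  have hPs : P.toFinset ⊆ (Finset.range n).erase q := by
    intro i hi
    rw [List.mem_toFinset] at hi
    rw [Finset.mem_erase, Finset.mem_range]
    exact ⟨fun h => hqP (h ▸ hi), hlt i hi⟩
  have h1 := card_le_card hPs
  rw [card_erase_of_mem (Finset.mem_range.2 hq), card_range, List.toFinset_card_of_nodup hnd] at h1
  have h2 : Finset.range n ⊆ P.toFinset ∪ E := by
    intro i hi
    rw [Finset.mem_range] at hi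
    by_cases h : i ∈ P
    · simp [h]
    · simp [hPE i hi h]
  have h3 := card_le_card h2
  have h4 := card_union_le P.toFinset E
  rw [card_range] at h3
  rw [List.toFinset_card_of_nodup hnd] at h4
  apply S.nocyc
  rw [← S.card]
  refine cycle_of_missing G k S.kpos W S.alpha (by rw [S.card]; exact S.four)
    (n - 1 - P.length) (P.map f) hcyc ?_ (by omega) ?_
  · rw [S.card, List.length_map]; omega
  · intro v hv
    obtain ⟨i, hi, rfl⟩ := S.surj v
    exact hgood i (hPE i hi (fun h => hv (List.mem_map_of_mem h)))

theorem Setting.chord1 (S : Setting G n k W f) (x₁ x₂ : ℕ) (h12 : x₁ + 2 ≤ x₂) (h2 : x₂ < n)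
    (hadj : G.Adj (f x₁) (f x₂)) (hlen : x₂ - x₁ ≤ 2 * k)
    (hg : ∀ i, x₁ < i → i < x₂ → GoodPos G k W f i) : False := by
  have hk := S.kpos
  have e1 : x₂ ≤ n - 1 := by omega
  have e2 : 0 ≤ x₁ := by omega
  refine S.no_list (segL x₂ (n - 1) ++ segL 0 x₁) ?_ ?_ ?_ ?_ (x₁ + 1) (by omega) ?_
    (Finset.Ioo x₁ x₂) ?_ ?_ ?_
  · simp only [List.nodup_append', nodup_segL, true_and, List.Disjoint, mem_segL]
    intros; omega
  · simp only [List.mem_append, mem_segL]; intros; omega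
  · simp only [List.isChain_append, chain_segL (fun i j => G.Adj (f i) (f j)) S.adj, head_segL, last_segL, e1, e2, true_and]
    simpa using S.wrap
  · simp only [List.head?_append, List.getLast?_append, head_segL, last_segL, e1, e2]
    simpa using hadj
  · simp only [List.mem_append, mem_segL]; omega
  · simp; omega
  · simp only [List.mem_append, mem_segL, Finset.mem_Ioo]; intros; omega
  · simp only [Finset.mem_Ioo]; intro i hi; exact hg i hi.1 hi.2

theorem Setting.chord2 (S : Setting G n k W f) (x₁ x₂ y₁ y₂ : ℕ) (h12 : x₁ + 2 ≤ x₂)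
    (hxy : x₂ < y₁) (hy : y₁ < y₂) (h2 : y₂ < n)
    (hadj1 : G.Adj (f x₁) (f y₁)) (hadj2 : G.Adj (f x₂) (f y₂))
    (hlenx : x₂ - x₁ ≤ 2 * k) (hleny : y₂ - y₁ ≤ 2 * k)
    (hgx : ∀ i, x₁ < i → i < x₂ → GoodPos G k W f i)
    (hgy : ∀ i, y₁ < i → i < y₂ → GoodPos G k W f i) : False := by
  have hk := S.kpos
  have e1 : y₂ ≤ n - 1 := by omega
  have e2 : 0 ≤ x₁ := by omega
  have e3 : x₂ ≤ y₁ := by omega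
  refine S.no_list ((segL y₂ (n - 1) ++ segL 0 x₁) ++ (segL x₂ y₁).reverse) ?_ ?_ ?_ ?_
    (x₁ + 1) (by omega) ?_ (Finset.Ioo x₁ x₂ ∪ Finset.Ioo y₁ y₂) ?_ ?_ ?_
  · simp only [List.nodup_append', nodup_segL, true_and, List.Disjoint, mem_segL,
      List.nodup_reverse, List.mem_append, List.mem_reverse]
    constructor <;> · intros; omega
  · simp only [List.mem_append, mem_segL, List.mem_reverse]; intros; omega
  · simp only [List.isChain_append, chain_segL (fun i j => G.Adj (f i) (f j)) S.adj, head_segL, last_segL, e1, e2, e3, true_and,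
      List.isChain_reverse, List.head?_append, List.getLast?_append, List.head?_reverse,
      chain_segL (fun i j => G.Adj (f j) (f i)) (fun i => (S.adj i).symm)]
    refine ⟨?_, ?_⟩
    · simpa using S.wrap
    · simpa using hadj1
  · simp only [List.head?_append, List.getLast?_append, head_segL, last_segL, e1, e2, e3,
      List.getLast?_reverse]
    simpa using hadj2
  · simp only [List.mem_append, mem_segL, List.mem_reverse]; omega
  · refine (card_union_le _ _).trans ?_
    simp; omega
  · simp only [List.mem_append, mem_segL, Finset.mem_Ioo, List.mem_reverse, Finset.mem_union]
    intros; omega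
  · simp only [Finset.mem_Ioo, Finset.mem_union]
    rintro i (hi | hi)
    · exact hgx i hi.1 hi.2
    · exact hgy i hi.1 hi.2

theorem Setting.chord4 (S : Setting G n k W f) (a₁ a₂ b₁ b₂ c₁ c₂ d₁ d₂ : ℕ) (h12 : a₁ + 2 ≤ a₂)
    (hab : a₂ < b₁) (hb : b₁ < b₂) (hbc : b₂ < c₁) (hc : c₁ < c₂) (hcd : c₂ < d₁) (hd : d₁ < d₂)
    (h2 : d₂ < n)
    (hadj1 : G.Adj (f a₁) (f c₂)) (hadj2 : G.Adj (f a₂) (f c₁))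
    (hadj3 : G.Adj (f b₁) (f d₂)) (hadj4 : G.Adj (f b₂) (f d₁))
    (hlena : a₂ - a₁ ≤ 2 * k) (hlenb : b₂ - b₁ ≤ 2 * k)
    (hlenc : c₂ - c₁ ≤ 2 * k) (hlend : d₂ - d₁ ≤ 2 * k)
    (hga : ∀ i, a₁ < i → i < a₂ → GoodPos G k W f i)
    (hgb : ∀ i, b₁ < i → i < b₂ → GoodPos G k W f i)
    (hgc : ∀ i, c₁ < i → i < c₂ → GoodPos G k W f i)
    (hgd : ∀ i, d₁ < i → i < d₂ → GoodPos G k W f i) : False := by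
  have hk := S.kpos
  have e1 : d₂ ≤ n - 1 := by omega
  have e2 : 0 ≤ a₁ := by omega
  have e3 : c₂ ≤ d₁ := by omega
  have e4 : b₂ ≤ c₁ := by omega
  have e5 : a₂ ≤ b₁ := by omega
  refine S.no_list (segL d₂ (n - 1) ++ (segL 0 a₁ ++ (segL c₂ d₁ ++ (segL b₂ c₁ ++ segL a₂ b₁))))
    ?_ ?_ ?_ ?_ (a₁ + 1) (by omega) ?_
    ((Finset.Ioo a₁ a₂ ∪ Finset.Ioo b₁ b₂) ∪ (Finset.Ioo c₁ c₂ ∪ Finset.Ioo d₁ d₂)) ?_ ?_ ?_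
  · simp only [List.nodup_append', nodup_segL, true_and, List.Disjoint, mem_segL,
      List.mem_append]
    refine ⟨⟨⟨?_, ?_⟩, ?_⟩, ?_⟩ <;> · intros; omega
  · simp only [List.mem_append, mem_segL]; intros; omega
  · simp only [List.isChain_append, chain_segL (fun i j => G.Adj (f i) (f j)) S.adj, head_segL, last_segL, e1, e2, e3, e4, e5,
      true_and, List.head?_append, List.getLast?_append]
    refine ⟨⟨⟨?_, ?_⟩, ?_⟩, ?_⟩
    · simpa using hadj2.symm
    · simpa using hadj4.symm
    · simpa using hadj1
    · simpa using S.wrap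
  · simp only [List.head?_append, List.getLast?_append, head_segL, last_segL, e1, e2, e3, e4, e5]
    simpa using hadj3
  · simp only [List.mem_append, mem_segL]; omega
  · refine (card_union_le _ _).trans ?_
    refine (add_le_add (card_union_le _ _) (card_union_le _ _)).trans ?_
    simp; omega
  · simp only [List.mem_append, mem_segL, Finset.mem_Ioo, Finset.mem_union]
    intros; omega
  · simp only [Finset.mem_Ioo, Finset.mem_union]
    rintro i ((hi | hi) | (hi | hi))
    · exact hga i hi.1 hi.2
    · exact hgb i hi.1 hi.2
    · exact hgc i hi.1 hi.2
    · exact hgd i hi.1 hi.2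

end

/-- Start of the `j`-th block of length `2m`. -/
def bs (m j : ℕ) : ℕ := 2 * m * j

theorem bs_lt {m p q : ℕ} (h : p < q) : bs m p + 2 * m ≤ bs m q := by
  have : 2 * m * (p + 1) ≤ 2 * m * q := Nat.mul_le_mul_left _ h
  simp only [bs]
  rw [mul_add, mul_one] at this
  exact this

/-- Two nested chords between blocks `p` and `q`. -/
def Nest {V : Type} (G : SimpleGraph V) (f : ℕ → V) (m p q : ℕ) : Prop :=
  ∃ a₁ a₂ b₁ b₂, a₁ < a₂ ∧ a₂ < m ∧ b₁ < b₂ ∧ b₂ < m ∧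
    G.Adj (f (bs m p + 2 * a₁)) (f (bs m q + 2 * b₂)) ∧
    G.Adj (f (bs m p + 2 * a₂)) (f (bs m q + 2 * b₁))

section
variable {V : Type} [Fintype V] [DecidableEq V] {G : SimpleGraph V}
    [DecidableRel G.Adj] {n k : ℕ} {W : Finset V} {f : ℕ → V}

theorem Nest.symm {m p q : ℕ} (h : Nest G f m p q) : Nest G f m q p := by
  obtain ⟨a₁, a₂, b₁, b₂, h1, h2, h3, h4, h5, h6⟩ := h
  exact ⟨b₁, b₂, a₁, a₂, h3, h4, h1, h2, h6.symm, h5.symm⟩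

/-- The `j`-th block lies inside the cycle and all of its positions are good. -/
def GoodBlock (G : SimpleGraph V) [DecidableRel G.Adj] (n k : ℕ) (W : Finset V) (f : ℕ → V)
    (m j : ℕ) : Prop :=
  bs m j + 2 * m ≤ n ∧ ∀ i, bs m j ≤ i → i < bs m j + 2 * m → GoodPos G k W f i

theorem Setting.block_indep (S : Setting G n k W f) {m j : ℕ} (hm : m ≤ k + 1)
    (hj : GoodBlock G n k W f m j) (a b : ℕ) (ha : a < m) (hb : b < m) :
    ¬ G.Adj (f (bs m j + 2 * a)) (f (bs m j + 2 * b)) := by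
  obtain ⟨h1, h2⟩ := hj
  intro hadj
  rcases lt_trichotomy a b with h | h | h
  · exact S.chord1 _ _ (by omega) (by omega) hadj (by omega)
      (fun i _ _ => h2 i (by omega) (by omega))
  · rw [h] at hadj; exact G.loopless.irrefl _ hadj
  · exact S.chord1 _ _ (by omega) (by omega) hadj.symm (by omega)
      (fun i _ _ => h2 i (by omega) (by omega))

theorem Setting.block_cross (S : Setting G n k W f) {m p q : ℕ} (hm : m ≤ k + 1)
    (hp : GoodBlock G n k W f m p) (hq : GoodBlock G n k W f m q) (hpq : p < q)
    (a₁ a₂ b₁ b₂ : ℕ) (ha : a₁ < a₂) (ha2 : a₂ < m) (hb : b₁ < b₂) (hb2 : b₂ < m)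
    (h1 : G.Adj (f (bs m p + 2 * a₁)) (f (bs m q + 2 * b₁)))
    (h2 : G.Adj (f (bs m p + 2 * a₂)) (f (bs m q + 2 * b₂))) : False := by
  obtain ⟨p1, p2⟩ := hp
  obtain ⟨q1, q2⟩ := hq
  have := bs_lt (m := m) hpq
  exact S.chord2 _ _ _ _ (by omega) (by omega) (by omega) (by omega) h1 h2 (by omega) (by omega)
    (fun i _ _ => p2 i (by omega) (by omega)) (fun i _ _ => q2 i (by omega) (by omega))

theorem Setting.block_nest (S : Setting G n k W f) {m p q r s : ℕ} (hm : m ≤ k + 1)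
    (hp : GoodBlock G n k W f m p) (hq : GoodBlock G n k W f m q)
    (hr : GoodBlock G n k W f m r) (hs : GoodBlock G n k W f m s)
    (hpq : p < q) (hqr : q < r) (hrs : r < s)
    (h1 : Nest G f m p r) (h2 : Nest G f m q s) : False := by
  obtain ⟨p1, p2⟩ := hp
  obtain ⟨q1, q2⟩ := hq
  obtain ⟨r1, r2⟩ := hr
  obtain ⟨s1, s2⟩ := hs
  have := bs_lt (m := m) hpq
  have := bs_lt (m := m) hqr
  have := bs_lt (m := m) hrs
  obtain ⟨a₁, a₂, c₁, c₂, ha, ha2, hc, hc2, e1, e2⟩ := h1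
  obtain ⟨b₁, b₂, d₁, d₂, hb, hb2, hd, hd2, e3, e4⟩ := h2
  exact S.chord4 _ _ _ _ _ _ _ _ (by omega) (by omega) (by omega) (by omega) (by omega) (by omega)
    (by omega) (by omega) e1 e2 e3 e4 (by omega) (by omega) (by omega) (by omega)
    (fun i _ _ => p2 i (by omega) (by omega)) (fun i _ _ => q2 i (by omega) (by omega))
    (fun i _ _ => r2 i (by omega) (by omega)) (fun i _ _ => s2 i (by omega) (by omega))

theorem Setting.exists_blocks (S : Setting G n k W f) (hW : W.card ≤ 20 * k ^ 2) (m : ℕ)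
    (hm : 1 ≤ m) : ∃ J : Finset ℕ, n / (2 * m) ≤ J.card + 31 * k ^ 2 ∧
      ∀ j ∈ J, GoodBlock G n k W f m j := by
  set L := (Finset.univ : Finset V).filter (fun v => G.degree v ≤ 10 * k) with hL
  have hLc : L.card ≤ 11 * k ^ 2 := by
    obtain ⟨I, _, hI, hc⟩ := greedy_indep G.Adj (fun _ _ h => h.symm) (10 * k) _ L rfl (by
      intro T hT ⟨v, hv⟩
      refine ⟨v, hv, ?_⟩
      have h1 := hT hv
      simp only [hL, mem_filter] at h1
      refine le_trans ?_ h1.2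
      rw [← SimpleGraph.card_neighborFinset_eq_degree]
      apply card_le_card
      intro u hu
      simp only [mem_filter] at hu
      rw [SimpleGraph.mem_neighborFinset]
      exact hu.2.2)
    have h1 := S.alpha I hI
    have h2 := S.kpos
    have h3 : (10 * k + 1) * I.card ≤ (11 * k) * k := Nat.mul_le_mul (by omega) h1
    nlinarith
  choose p hp hfp using S.surj
  have hpf : ∀ i < n, p (f i) = i := fun i hi => S.inj _ (hp _) _ hi (hfp _)
  refine ⟨Finset.range (n / (2 * m)) \ (L ∪ W).image (fun v => p v / (2 * m)), ?_, ?_⟩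
  · have h1 := le_card_sdiff ((L ∪ W).image (fun v => p v / (2 * m))) (Finset.range (n / (2 * m)))
    have h2 : ((L ∪ W).image (fun v => p v / (2 * m))).card ≤ (L ∪ W).card := card_image_le
    have h3 := card_union_le L W
    rw [card_range] at h1
    omega
  · intro j hj
    rw [Finset.mem_sdiff, Finset.mem_range] at hj
    obtain ⟨hj1, hj2⟩ := hj
    have hb : bs m j + 2 * m ≤ n := by
      have h1 : 2 * m * (j + 1) ≤ 2 * m * (n / (2 * m)) := Nat.mul_le_mul_left _ hj1
      have h2 := Nat.mul_div_le n (2 * m)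
      rw [mul_add, mul_one] at h1
      simp only [bs]; omega
    refine ⟨hb, fun i hi1 hi2 => ?_⟩
    have hi : f i ∉ L ∪ W := by
      intro h
      apply hj2
      rw [mem_image]
      refine ⟨_, h, ?_⟩
      rw [hpf i (by omega)]
      apply Nat.div_eq_of_lt_le
      · rw [mul_comm]; exact hi1
      · rw [mul_comm, mul_add, mul_one]; exact hi2
    rw [Finset.mem_union, not_or] at hi
    refine ⟨?_, hi.2⟩
    have := hi.1
    simp only [hL, mem_filter, Finset.mem_univ, true_and] at this
    omega

end

section
variable {V : Type} [Fintype V] [DecidableEq V] {G : SimpleGraph V}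
    [DecidableRel G.Adj] {n k : ℕ} {W : Finset V}

theorem setting_of_star {σ : ZMod n → V} {c : ℝ} (h : StarAssumption G n k σ W c) (hn : 4 ≤ n)
    (hk : 1 ≤ k) : Setting G n k W (fun i : ℕ => σ (i : ZMod n)) := by
  obtain ⟨hcard, ⟨hbij, hadj⟩, hα, hW, hno, hc⟩ := h
  haveI : NeZero n := ⟨by omega⟩
  refine ⟨hcard, hn, hk, hα, hno, ?_, ?_, ?_, ?_⟩
  · intro i hi j hj hij
    have h1 := hbij.1 hij
    have h2 := congrArg ZMod.val h1
    rwa [ZMod.val_natCast_of_lt hi, ZMod.val_natCast_of_lt hj] at h2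
  · intro v
    obtain ⟨x, hx⟩ := hbij.2 v
    exact ⟨x.val, ZMod.val_lt x, by simpa using hx⟩
  · intro i
    have := hadj (i : ZMod n)
    simpa using this
  · have h1 := hadj ((n - 1 : ℕ) : ZMod n)
    have h2 : ((n - 1 : ℕ) : ZMod n) + 1 = ((0 : ℕ) : ZMod n) := by
      have : (((n - 1) + 1 : ℕ) : ZMod n) = ((0 : ℕ) : ZMod n) := by
        rw [show (n - 1) + 1 = n by omega]; simp
      rw [← this]; push_cast; rfl
    rw [h2] at h1
    exact h1

/-- The arc of block `j`: every other vertex. -/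
def arcA (f : ℕ → V) (m j : ℕ) : Finset V := (Finset.range m).image (fun a => f (bs m j + 2 * a))

/-- The continuous closure of the arc of block `j`. -/
def arcC (f : ℕ → V) (m j : ℕ) : Finset V :=
  (Finset.range (2 * m - 1)).image (fun a => f (bs m j + a))

theorem card_arcA {f : ℕ → V} (S : Setting G n k W f) {m j : ℕ} (hj : bs m j + 2 * m ≤ n) :
    (arcA f m j).card = m := by
  rw [arcA, card_image_of_injOn, card_range]
  intro a ha b hb h
  simp only [Finset.coe_range, Set.mem_Iio] at ha hb
  have := S.inj _ (by omega) _ (by omega) h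
  omega

theorem card_arcC {f : ℕ → V} (S : Setting G n k W f) {m j : ℕ} (hj : bs m j + 2 * m ≤ n) :
    (arcC f m j).card = 2 * m - 1 := by
  rw [arcC, card_image_of_injOn, card_range]
  intro a ha b hb h
  simp only [Finset.coe_range, Set.mem_Iio] at ha hb
  have := S.inj _ (by omega) _ (by omega) h
  omega

theorem arc_closure {σ : ZMod n → V} (hσ : Function.Injective σ)
    (S : Setting G n k W (fun i : ℕ => σ (i : ZMod n))) {m j : ℕ} (hm : 1 ≤ m)
    (hj : bs m j + 2 * m ≤ n) :
    IsClosure n σ (arcA (fun i : ℕ => σ (i : ZMod n)) m j)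
      (arcC (fun i : ℕ => σ (i : ZMod n)) m j) := by
  set f : ℕ → V := fun i : ℕ => σ (i : ZMod n) with hf
  have hfour := S.four
  haveI : NeZero n := ⟨by omega⟩
  refine ⟨⟨(bs m j : ZMod n), 2 * m - 1, ?_⟩, ?_, ?_⟩
  · simp only [arcC, hf]; push_cast; rfl
  · intro v hv
    simp only [arcA, arcC, mem_image, Finset.mem_range] at hv ⊢
    obtain ⟨a, ha, rfl⟩ := hv
    exact ⟨2 * a, by omega, rfl⟩
  · rintro B' ⟨s, t, rfl⟩ hsub
    set B' := (Finset.range t).image (fun j : ℕ => σ (s + (j : ZMod n))) with hB'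
    by_cases hCB : arcC f m j ⊆ B'
    · exact card_le_card hCB
    rw [card_arcC S hj]
    obtain ⟨v, hv, hvB⟩ := Finset.not_subset.1 hCB
    simp only [arcC, mem_image, Finset.mem_range] at hv
    obtain ⟨i, hi, rfl⟩ := hv
    have hA : ∀ a < m, f (bs m j + 2 * a) ∈ B' := fun a ha => hsub (by
      simp only [arcA, mem_image, Finset.mem_range]; exact ⟨a, ha, rfl⟩)
    obtain ⟨a, ha⟩ : ∃ a, i = 2 * a + 1 := by
      rcases Nat.even_or_odd' i with ⟨a, h | h⟩
      · exact absurd (h ▸ hA a (by omega)) hvB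
      · exact ⟨a, h⟩
    have h1 := hA a (by omega)
    have h2 := hA (a + 1) (by omega)
    simp only [hB', mem_image, Finset.mem_range, hf] at h1 h2
    obtain ⟨b, hb, hb'⟩ := h2
    obtain ⟨d, hd, hd'⟩ := h1
    have hb'' := hσ hb'
    have hd'' := hσ hd'
    have hb0 : b = 0 := by
      by_contra hne
      apply hvB
      simp only [hB', mem_image, Finset.mem_range, hf]
      refine ⟨b - 1, by omega, ?_⟩
      obtain ⟨b', rfl⟩ := Nat.exists_eq_succ_of_ne_zero hne
      congr 1
      subst ha
      push_cast at hb'' ⊢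
      linear_combination hb''
    subst hb0
    have hz : ((d + 2 : ℕ) : ZMod n) = 0 := by
      push_cast at hb'' hd'' ⊢
      linear_combination hd'' - hb''
    have hdvd := (ZMod.natCast_eq_zero_iff _ _).1 hz
    have hle := Nat.le_of_dvd (by omega) hdvd
    have hsub2 : (Finset.range (n - 1)).image (fun j : ℕ => σ (s + (j : ZMod n))) ⊆ B' := by
      apply image_subset_image
      intro x hx
      rw [Finset.mem_range] at hx ⊢
      omega
    have h3 := card_le_card hsub2
    rw [card_image_of_injOn, card_range] at h3
    · omega
    · intro x hx y hy hxy
      simp only [Finset.coe_range, Set.mem_Iio] at hx hy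
      have h4 := add_left_cancel (hσ hxy)
      have h5 := congrArg ZMod.val h4
      rwa [ZMod.val_natCast_of_lt (by omega), ZMod.val_natCast_of_lt (by omega)] at h5

theorem arc_noconsec {σ : ZMod n → V} (hσ : Function.Injective σ)
    (S : Setting G n k W (fun i : ℕ => σ (i : ZMod n))) {m j : ℕ}
    (hj : bs m j + 2 * m ≤ n) (a b : ℕ) (ha : a < m) (hb : b < m) (i : ZMod n)
    (h1 : σ i = σ ((bs m j + 2 * a : ℕ) : ZMod n))
    (h2 : σ (i + 1) = σ ((bs m j + 2 * b : ℕ) : ZMod n)) : False := by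
  have e1 := hσ h1
  subst e1
  have h3 : σ ((bs m j + 2 * a + 1 : ℕ) : ZMod n) = σ ((bs m j + 2 * b : ℕ) : ZMod n) := by
    rw [← h2]; push_cast; rfl
  have := S.inj (bs m j + 2 * a + 1) (by omega) (bs m j + 2 * b) (by omega) h3
  omega

theorem arc_m2free {f : ℕ → V} (S : Setting G n k W f) {m p q : ℕ} (hm : m ≤ k + 1)
    (hp : GoodBlock G n k W f m p) (hq : GoodBlock G n k W f m q) (hpq : p < q)
    (hN : ¬ Nest G f m p q) : M2Free G (arcA f m p ∪ arcA f m q) := by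
  have key : ∀ a b x y, a < m → b < m → x < m → y < m →
      G.Adj (f (bs m p + 2 * a)) (f (bs m q + 2 * b)) →
      G.Adj (f (bs m p + 2 * x)) (f (bs m q + 2 * y)) → a ≠ x → b ≠ y → False := by
    intro a b x y ha hb hx hy h1 h2 hax hby
    rcases lt_or_gt_of_ne hax with h | h <;> rcases lt_or_gt_of_ne hby with h' | h'
    · exact S.block_cross hm hp hq hpq a x b y h hx h' hy h1 h2
    · exact hN ⟨a, x, y, b, h, hx, h', hb, h1, h2⟩
    · exact hN ⟨x, a, b, y, h, ha, h', hy, h2, h1⟩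
    · exact S.block_cross hm hp hq hpq x a y b h ha h' hb h2 h1
  rintro ⟨a, b, x, y, ha, hb, hx, hy, hab, hxy, n1, n2, n3, n4⟩
  -- every edge runs between the two blocks
  have edge : ∀ u v, u ∈ arcA f m p ∪ arcA f m q → v ∈ arcA f m p ∪ arcA f m q → G.Adj u v →
      ∃ i < m, ∃ j < m, G.Adj (f (bs m p + 2 * i)) (f (bs m q + 2 * j)) ∧
        ((u = f (bs m p + 2 * i) ∧ v = f (bs m q + 2 * j)) ∨
          (v = f (bs m p + 2 * i) ∧ u = f (bs m q + 2 * j))) := by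
    intro u v hu hv huv
    simp only [arcA, Finset.mem_union, mem_image, Finset.mem_range] at hu hv
    rcases hu with ⟨i, hi, rfl⟩ | ⟨i, hi, rfl⟩ <;> rcases hv with ⟨j, hj, rfl⟩ | ⟨j, hj, rfl⟩
    · exact absurd huv (S.block_indep hm hp i j hi hj)
    · exact ⟨i, hi, j, hj, huv, Or.inl ⟨rfl, rfl⟩⟩
    · exact ⟨j, hj, i, hi, huv.symm, Or.inr ⟨rfl, rfl⟩⟩
    · exact absurd huv (S.block_indep hm hq i j hi hj)
  obtain ⟨i, hi, j, hj, e1, o1⟩ := edge a b ha hb hab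
  obtain ⟨i', hi', j', hj', e2, o2⟩ := edge x y hx hy hxy
  refine key i j i' j' hi hj hi' hj' e1 e2 ?_ ?_
  · rintro rfl
    rcases o1 with ⟨rfl, rfl⟩ | ⟨rfl, rfl⟩ <;> rcases o2 with ⟨rfl, rfl⟩ | ⟨rfl, rfl⟩ <;> simp_all
  · rintro rfl
    rcases o1 with ⟨rfl, rfl⟩ | ⟨rfl, rfl⟩ <;> rcases o2 with ⟨rfl, rfl⟩ | ⟨rfl, rfl⟩ <;> simp_all

/-- No good block of length `2(k+1)` exists. -/
theorem no_long_block {f : ℕ → V} (S : Setting G n k W f) (j : ℕ)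
    (hj : GoodBlock G n k W f (k + 1) j) : False := by
  have h1 := card_arcA S hj.1
  have h2 := S.alpha (arcA f (k + 1) j) (by
    intro u hu v hv _
    simp only [arcA, mem_image, Finset.mem_range] at hu hv
    obtain ⟨a, ha, rfl⟩ := hu
    obtain ⟨b, hb, rfl⟩ := hv
    exact S.block_indep le_rfl hj a b ha hb)
  omega

theorem exists_system {σ : ZMod n → V} (hσ : Function.Injective σ)
    (S : Setting G n k W (fun i : ℕ => σ (i : ZMod n))) (hW : W.card ≤ 20 * k ^ 2) (m : ℕ)
    (hm : 1 ≤ m) (hmk : 2 * m - 1 ≤ k) :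
    ∃ 𝒜 : ArcSystem G n k σ W, 𝒜.Simple ∧ n / (2 * m) ≤ 3 * 𝒜.arcs.card + 31 * k ^ 2 ∧
      ∀ A ∈ 𝒜.arcs, A.card = m := by
  set f : ℕ → V := fun i : ℕ => σ (i : ZMod n) with hf
  obtain ⟨J, hJc, hJ⟩ := S.exists_blocks hW m hm
  have hmk' : m ≤ k + 1 := by omega
  obtain ⟨I, hIJ, hI, hIc⟩ := noncrossing_indep (Nest G f m) (fun _ _ h => h.symm) J
    (fun p hp q hq r hr s hs h1 h2 h3 h4 h5 =>
      S.block_nest hmk' (hJ p hp) (hJ q hq) (hJ r hr) (hJ s hs) h1 h2 h3 h4 h5)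
  have hG : ∀ j ∈ I, GoodBlock G n k W f m j := fun j hj => hJ j (hIJ hj)
  have hdisj : ∀ p ∈ I, ∀ q ∈ I, p ≠ q → Disjoint (arcC f m p) (arcC f m q) := by
    intro p hp q hq hpq
    rw [Finset.disjoint_left]
    intro v hv hv'
    simp only [arcC, mem_image, Finset.mem_range] at hv hv'
    obtain ⟨a, ha, rfl⟩ := hv
    obtain ⟨b, hb, hab⟩ := hv'
    have h1 := (hG p hp).1
    have h2 := (hG q hq).1
    have h3 := S.inj _ (by omega) _ (by omega) hab
    rcases lt_or_gt_of_ne hpq with h | h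
    · have := bs_lt (m := m) h; omega
    · have := bs_lt (m := m) h; omega
  have hcl : ∀ j ∈ I, IsClosure n σ (arcA f m j) (arcC f m j) := fun j hj =>
    arc_closure hσ S hm (hG j hj).1
  have hinj : ∀ p ∈ I, ∀ q ∈ I, arcA f m p = arcA f m q → p = q := by
    intro p hp q hq h
    by_contra hne
    have hd := hdisj p hp q hq hne
    have h0 : f (bs m p + 2 * 0) ∈ arcA f m p :=
      mem_image_of_mem (fun a => f (bs m p + 2 * a)) (Finset.mem_range.2 hm)
    exact Finset.disjoint_left.1 hd ((hcl p hp).2.1 h0) ((hcl q hq).2.1 (h ▸ h0))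
  let idx : Finset V → ℕ := fun A => if h : ∃ j ∈ I, arcA f m j = A then h.choose else 0
  have hidx : ∀ j ∈ I, idx (arcA f m j) = j := by
    intro j hj
    have h : ∃ j' ∈ I, arcA f m j' = arcA f m j := ⟨j, hj, rfl⟩
    have e : idx (arcA f m j) = h.choose := dif_pos h
    rw [e]
    exact hinj _ h.choose_spec.1 _ hj h.choose_spec.2
  let 𝒜 : ArcSystem G n k σ W :=
    { arcs := I.image (arcA f m)
      cl := fun A => arcC f m (idx A)
      closure_spec := by
        intro A hA
        obtain ⟨j, hj, rfl⟩ := mem_image.1 hA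
        rw [hidx j hj]
        exact hcl j hj
      closures_disjoint := by
        intro A hA B hB hAB
        obtain ⟨p, hp, rfl⟩ := mem_image.1 hA
        obtain ⟨q, hq, rfl⟩ := mem_image.1 hB
        rw [hidx p hp, hidx q hq]
        exact hdisj p hp q hq (fun h => hAB (by rw [h]))
      no_problematic := by
        intro A hA v hv
        obtain ⟨j, hj, rfl⟩ := mem_image.1 hA
        rw [hidx j hj] at hv
        simp only [arcC, mem_image, Finset.mem_range] at hv
        obtain ⟨a, ha, rfl⟩ := hv
        have := (hG j hj).2 (bs m j + a) (by omega) (by omega)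
        rintro (h | h)
        · have := this.1
          omega
        · exact this.2 h
      no_consec := by
        intro A hA u hu v hv huv
        obtain ⟨j, hj, rfl⟩ := mem_image.1 hA
        simp only [arcA, mem_image, Finset.mem_range] at hu hv
        obtain ⟨a, ha, rfl⟩ := hu
        obtain ⟨b, hb, rfl⟩ := hv
        rintro ⟨i, ⟨h1, h2⟩ | ⟨h1, h2⟩⟩
        · exact arc_noconsec hσ S (hG j hj).1 a b ha hb i h1 h2
        · exact arc_noconsec hσ S (hG j hj).1 b a hb ha i h1 h2 }
  refine ⟨𝒜, ⟨?_, ?_⟩, ?_, ?_⟩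
  · intro A hA
    obtain ⟨j, hj, rfl⟩ := mem_image.1 hA
    change (arcC f m (idx (arcA f m j))).card ≤ k
    rw [hidx j hj, card_arcC S (hG j hj).1]
    exact hmk
  · intro A hA B hB hAB
    obtain ⟨p, hp, rfl⟩ := mem_image.1 hA
    obtain ⟨q, hq, rfl⟩ := mem_image.1 hB
    have hpq : p ≠ q := fun h => hAB (by rw [h])
    rcases lt_or_gt_of_ne hpq with h | h
    · exact arc_m2free S hmk' (hG p hp) (hG q hq) h (hI p hp q hq hpq)
    · rw [Finset.union_comm]
      exact arc_m2free S hmk' (hG q hq) (hG p hp) h (hI q hq p hp hpq.symm)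
  · have : 𝒜.arcs.card = I.card := card_image_of_injOn (fun p hp q hq h => hinj p hp q hq h)
    rw [this]
    omega
  · intro A hA
    obtain ⟨j, hj, rfl⟩ := mem_image.1 hA
    exact card_arcA S (hG j hj).1

end

/-- For all `c₁, c₂ > 0` there is `c > 0` such that under Assumption (★)
with constant `c`, `G` contains a simple arc-system of size at least `c₁·k²` and length at
least `c₂·k^(1/5)`. -/
theorem statement6 :
    ∀ c₁ c₂ : ℝ, 0 < c₁ → 0 < c₂ →
      ∃ c : ℝ, 0 < c ∧
        ∀ (V : Type) [Fintype V] [DecidableEq V] (G : SimpleGraph V) [DecidableRel G.Adj]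
          (n k : ℕ) (σ : ZMod n → V) (W : Finset V),
          StarAssumption G n k σ W c →
          ∃ 𝒜 : ArcSystem G n k σ W, 𝒜.Simple ∧
            c₁ * (k : ℝ) ^ 2 ≤ (𝒜.arcs.card : ℝ) ∧
            ∀ A ∈ 𝒜.arcs, c₂ * (k : ℝ) ^ ((1 : ℝ) / 5) ≤ (A.card : ℝ) := by
  intro c₁ c₂ hc₁ hc₂
  set E : ℝ := 2 * (c₂ + 1) with hE
  have hE2 : 2 ≤ E := by rw [hE]; linarith
  refine ⟨E * (3 * c₁ + 33) + 128 * E ^ 2, by positivity, ?_⟩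
  intro V _ _ G _ n k σ W hstar
  have hstar' := hstar
  obtain ⟨hcard, ⟨hbij, hadj⟩, hα, hW, hno, hc⟩ := hstar'
  rcases Nat.eq_zero_or_pos k with hk0 | hk
  · -- `k = 0`: the empty system works
    subst hk0
    let 𝒜 : ArcSystem G n 0 σ W :=
      { arcs := ∅
        cl := fun A => A
        closure_spec := by simp
        closures_disjoint := by simp
        no_problematic := by simp
        no_consec := by simp }
    have hemp : 𝒜.arcs = ∅ := rfl
    refine ⟨𝒜, ⟨?_, ?_⟩, ?_, ?_⟩
    · intro A hA; rw [hemp] at hA; simp at hA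
    · intro A hA; rw [hemp] at hA; simp at hA
    · rw [hemp]; simp
    · intro A hA; rw [hemp] at hA; simp at hA
  have hk1 : (1 : ℝ) ≤ k := by exact_mod_cast hk
  have hk0 : (0 : ℝ) ≤ k := by linarith
  obtain ⟨t, ht⟩ : ∃ t : ℝ, t = (k : ℝ) ^ ((1 : ℝ) / 5) := ⟨_, rfl⟩
  have ht1 : 1 ≤ t := by rw [ht]; exact Real.one_le_rpow hk1 (by norm_num)
  have htk : t ^ 5 = k := by
    rw [ht, ← Real.rpow_natCast, ← Real.rpow_mul hk0]; norm_num
  have ht11 : (k : ℝ) ^ ((11 : ℝ) / 5) = t ^ 11 := by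
    rw [ht, ← Real.rpow_natCast, ← Real.rpow_mul hk0]; norm_num
  have hk2 : (k : ℝ) ^ ((11 : ℝ) / 5) = k ^ 2 * t := by rw [ht11, ← htk]; ring
  rw [hk2] at hc
  rw [← ht]
  have hk2pos : (1 : ℝ) ≤ (k : ℝ) ^ 2 := one_le_pow₀ hk1
  have hkt : (k : ℝ) ^ 2 ≤ k ^ 2 * t := le_mul_of_one_le_right (by positivity) ht1
  have hn4 : 4 ≤ n := by
    have h1 : (4 : ℝ) ≤ E * (3 * c₁ + 33) + 128 * E ^ 2 := by nlinarith [mul_pos hc₁ (by linarith : 0 < E)]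
    have h2 : (4 : ℝ) * 1 ≤ (E * (3 * c₁ + 33) + 128 * E ^ 2) * (k ^ 2 * t) :=
      mul_le_mul h1 (hk2pos.trans hkt) (by norm_num) (by positivity)
    have h3 : (4 : ℝ) ≤ n := by linarith
    exact_mod_cast h3
  have S := setting_of_star hstar hn4 hk
  obtain ⟨m, hmdef⟩ : ∃ m : ℕ, m = ⌈c₂ * t⌉₊ := ⟨_, rfl⟩
  have hct : 0 < c₂ * t := by positivity
  have hm1 : 1 ≤ m := by rw [hmdef]; exact Nat.ceil_pos.2 hct
  have hmle : c₂ * t ≤ m := by rw [hmdef]; exact Nat.le_ceil _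
  have hmlt : (m : ℝ) < c₂ * t + 1 := by rw [hmdef]; exact Nat.ceil_lt_add_one hct.le
  have h2m : 2 * (m : ℝ) ≤ E * t := by rw [hE]; nlinarith
  by_cases hmk : 2 * m - 1 ≤ k
  · obtain ⟨𝒜, hs, hcnt, hlen⟩ := exists_system hbij.1 S hW m hm1 hmk
    refine ⟨𝒜, hs, ?_, fun A hA => by rw [hlen A hA]; exact hmle⟩
    have hdiv : (n : ℝ) < 2 * m * ((3 * (𝒜.arcs.card : ℝ) + 31 * k ^ 2) + 1) := by
      have h1 : n < 2 * m * (n / (2 * m) + 1) := Nat.lt_mul_div_succ n (by omega)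
      have h2 : 2 * m * (n / (2 * m) + 1) ≤ 2 * m * ((3 * 𝒜.arcs.card + 31 * k ^ 2) + 1) :=
        Nat.mul_le_mul_left _ (by omega)
      exact_mod_cast lt_of_lt_of_le h1 h2
    by_contra hlt
    push Not at hlt
    have h3 : 3 * (𝒜.arcs.card : ℝ) + 31 * k ^ 2 + 1 ≤ (3 * c₁ + 33) * k ^ 2 := by nlinarith
    have h4 : 2 * (m : ℝ) * ((3 * (𝒜.arcs.card : ℝ) + 31 * k ^ 2) + 1) ≤
        E * t * ((3 * c₁ + 33) * k ^ 2) := mul_le_mul h2m h3 (by positivity) (by positivity)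
    have h5 : 0 ≤ 128 * E ^ 2 * (k ^ 2 * t) := by positivity
    nlinarith
  · exfalso
    -- here `k` is bounded
    have h1 : k + 1 ≤ 2 * m := by omega
    have h2 : (k : ℝ) + 1 ≤ 2 * m := by exact_mod_cast h1
    have h3 : (k : ℝ) < E * t := by linarith
    have h4 : t ^ 4 < E := by
      rw [← htk] at h3
      have : t ^ 4 * t < E * t := by nlinarith
      exact lt_of_mul_lt_mul_right this (by linarith)
    have h5 : t ≤ t ^ 4 := le_self_pow₀ ht1 (by norm_num)
    have h6 : (k : ℝ) ≤ E ^ 2 := by nlinarith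
    obtain ⟨J, hJc, hJ⟩ := S.exists_blocks hW (k + 1) (by omega)
    have hJ0 : J = ∅ := by
      rw [Finset.eq_empty_iff_forall_notMem]
      intro j hj
      exact no_long_block S j (hJ j hj)
    rw [hJ0, card_empty, zero_add] at hJc
    have h7 : n < 2 * (k + 1) * (31 * k ^ 2 + 1) := by
      refine lt_of_lt_of_le (Nat.lt_mul_div_succ n (by omega : 0 < 2 * (k + 1))) ?_
      exact Nat.mul_le_mul_left _ (by omega)
    have h8 : (n : ℝ) < 2 * (k + 1) * (31 * k ^ 2 + 1) := by exact_mod_cast h7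
    have h9 : 2 * ((k : ℝ) + 1) * (31 * k ^ 2 + 1) ≤ (4 * E ^ 2) * (32 * k ^ 2) :=
      mul_le_mul (by linarith) (by linarith) (by positivity) (by positivity)
    have h10 : 0 ≤ E * (3 * c₁ + 33) * (k ^ 2 * t) := by positivity
    have h11 : 128 * E ^ 2 * (k : ℝ) ^ 2 ≤ 128 * E ^ 2 * (k ^ 2 * t) :=
      mul_le_mul_of_nonneg_left hkt (by positivity)
    nlinarith
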